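/- arXiv:2310.20221 — 2 statements merged into one kernel-verified Lean document; each statement's English description precedes it below -/
import Mathlib

section
/- For every k ≥ 1, if t(k) = (x, y) ∈ D3, then k + 8x + 3 ≥ 1 (note x < 0) and t(k + 8x + 3) = (x+1, y). (Equivalently, with i = −x−1 the number of completed turns of the spiral, the index of the point one step to the right of t(k) is k − (8i+5).) -/
namespace Spiral

/-- The origin. -/
def O : Set (ℤ × ℤ) := {p | p = (0, 0)}
/-- ℓ1 = {(x, −(x−1)) : x > 0}. -/
def l1 : Set (ℤ × ℤ) := {p | 0 < p.1 ∧ p.2 = -(p.1 - 1)}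
/-- ℓ2 = {(x, x) : x > 0}. -/
def l2 : Set (ℤ × ℤ) := {p | 0 < p.1 ∧ p.2 = p.1}
/-- ℓ3 = {(−x, x) : x > 0}. -/
def l3 : Set (ℤ × ℤ) := {p | 0 < p.2 ∧ p.1 = -p.2}
/-- ℓ4 = {(−x, −x) : x > 0}. -/
def l4 : Set (ℤ × ℤ) := {p | p.1 < 0 ∧ p.2 = p.1}
/-- D1 = {(x,y) : x > 1 and −(x−1) < y < x}. -/
def D1 : Set (ℤ × ℤ) := {p | 1 < p.1 ∧ -(p.1 - 1) < p.2 ∧ p.2 < p.1}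
/-- D2 = {(x,y) : y > 0 and −y < x < y}. -/
def D2 : Set (ℤ × ℤ) := {p | 0 < p.2 ∧ -p.2 < p.1 ∧ p.1 < p.2}
/-- D3 = {(x,y) : x < 0 and x < y < −x}. -/
def D3 : Set (ℤ × ℤ) := {p | p.1 < 0 ∧ p.1 < p.2 ∧ p.2 < -p.1}
/-- D4 = {(x,y) : y < 0 and y < x < −y+1}. -/
def D4 : Set (ℤ × ℤ) := {p | p.2 < 0 ∧ p.2 < p.1 ∧ p.1 < -p.2 + 1}

open scoped Classical in
/-- The step of the spiral at a point. -/
noncomputable def step (p : ℤ × ℤ) : ℤ × ℤ :=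
  if p ∈ l1 ∪ D1 then (0, 1)
  else if p ∈ l2 ∪ D2 then (-1, 0)
  else if p ∈ l3 ∪ D3 then (0, -1)
  else (1, 0)

/-- The spiral enumeration `t` (meaningful for indices `k ≥ 1`):
`t 1 = (0,0)` and `t (k+1) = t k + step (t k)` for `k ≥ 1`. -/
noncomputable def t : ℕ → ℤ × ℤ
  | 0 => (0, 0)
  | 1 => (0, 0)
  | k + 2 => t (k + 1) + step (t (k + 1))

theorem step_of_right {a b : ℤ} (h₁ : -a < b) (h₂ : b < a) : step (a, b) = (0, 1) := by
  simp only [step, l1, D1, Set.mem_union, Set.mem_ofPred_eq]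
  rw [if_pos (by omega)]

theorem step_of_top {a b : ℤ} (h₁ : -b < a) (h₂ : a ≤ b) : step (a, b) = (-1, 0) := by
  simp only [step, l1, D1, l2, D2, Set.mem_union, Set.mem_ofPred_eq]
  rw [if_neg (by omega), if_pos (by omega)]

theorem step_of_left {a b : ℤ} (h₁ : a < b) (h₂ : b ≤ -a) : step (a, b) = (0, -1) := by
  simp only [step, l1, D1, l2, D2, l3, D3, Set.mem_union, Set.mem_ofPred_eq]
  rw [if_neg (by omega), if_neg (by omega), if_pos (by omega)]

theorem step_of_bottom {a b : ℤ} (h₁ : b ≤ a) (h₂ : a ≤ -b) : step (a, b) = (1, 0) := by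
  simp only [step, l1, D1, l2, D2, l3, D3, Set.mem_union, Set.mem_ofPred_eq]
  rw [if_neg (by omega), if_neg (by omega), if_neg (by omega)]

theorem t_succ {k : ℕ} (hk : 1 ≤ k) : t (k + 1) = t k + step (t k) := by
  obtain ⟨k, rfl⟩ := Nat.exists_eq_add_of_le' hk
  rfl

/-- The position of a lattice point in the spiral enumeration. -/
def index (p : ℤ × ℤ) : ℤ :=
  if -p.1 < p.2 ∧ p.2 < p.1 then (2 * p.1 - 1) ^ 2 + p.1 + p.2
  else if -p.2 < p.1 ∧ p.1 ≤ p.2 then 4 * p.2 ^ 2 - p.2 + 1 - p.1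
  else if p.1 < p.2 ∧ p.2 ≤ -p.1 then 4 * p.1 ^ 2 + 1 - p.1 - p.2
  else 4 * p.2 ^ 2 - 3 * p.2 + 1 + p.1

theorem index_of_right {a b : ℤ} (h₁ : -a < b) (h₂ : b < a) :
    index (a, b) = (2 * a - 1) ^ 2 + a + b :=
  if_pos ⟨h₁, h₂⟩

theorem index_of_top {a b : ℤ} (h₁ : -b < a) (h₂ : a ≤ b) :
    index (a, b) = 4 * b ^ 2 - b + 1 - a := by
  simp only [index]
  rw [if_neg (by omega), if_pos (by omega)]

theorem index_of_left {a b : ℤ} (h₁ : a < b) (h₂ : b ≤ -a) :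
    index (a, b) = 4 * a ^ 2 + 1 - a - b := by
  simp only [index]
  rw [if_neg (by omega), if_neg (by omega), if_pos (by omega)]

theorem index_of_bottom {a b : ℤ} (h₁ : b ≤ a) (h₂ : a ≤ -b) :
    index (a, b) = 4 * b ^ 2 - 3 * b + 1 + a := by
  simp only [index]
  rw [if_neg (by omega), if_neg (by omega), if_neg (by omega)]

theorem index_add_step (p : ℤ × ℤ) : index (p + step p) = index p + 1 := by
  obtain ⟨a, b⟩ := p
  have hcases : (-a < b ∧ b < a) ∨ (-b < a ∧ a ≤ b) ∨ (a < b ∧ b ≤ -a) ∨ (b ≤ a ∧ a ≤ -b) := by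
    omega
  rcases hcases with ⟨h₁, h₂⟩ | ⟨h₁, h₂⟩ | ⟨h₁, h₂⟩ | ⟨h₁, h₂⟩
  · rw [step_of_right h₁ h₂, index_of_right h₁ h₂, Prod.mk_add_mk, add_zero]
    rcases (show b + 1 ≤ a by omega).lt_or_eq with h | rfl
    · rw [index_of_right (by omega) h]
      ring
    · rw [index_of_top (by omega) le_rfl]
      ring
  · rw [step_of_top h₁ h₂, index_of_top h₁ h₂, Prod.mk_add_mk, add_zero]
    rcases (show -b ≤ a + -1 by omega).lt_or_eq with h | h
    · rw [index_of_top h (by omega)]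
      ring
    · rw [index_of_left (by omega) (by omega), ← h]
      linear_combination -h
  · rw [step_of_left h₁ h₂, index_of_left h₁ h₂, Prod.mk_add_mk, add_zero]
    rcases (show a ≤ b + -1 by omega).lt_or_eq with h | h
    · rw [index_of_left h (by omega)]
      ring
    · rw [index_of_bottom (by omega) (by omega), ← h]
      linear_combination -h
  · rw [step_of_bottom h₁ h₂, index_of_bottom h₁ h₂, Prod.mk_add_mk, add_zero]
    rcases (show a + 1 ≤ -b + 1 by omega).lt_or_eq with h | h
    · rw [index_of_bottom (by omega) (by omega)]
      ring
    · obtain rfl : a = -b := by omega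
      rw [index_of_right (by omega) (by omega)]
      ring

theorem index_t {k : ℕ} (hk : 1 ≤ k) : index (t k) = k := by
  induction k, hk using Nat.le_induction with
  | base => simp [t, index]
  | succ k hk ih => rw [t_succ hk, index_add_step, ih, Nat.cast_succ]

/-- While the step is constantly `d`, the spiral moves in a straight line. -/
theorem t_add_of_step_eq {k m : ℕ} {p d : ℤ × ℤ} (hk : 1 ≤ k) (hp : t k = p)
    (hd : ∀ j < m, step (p + j • d) = d) : t (k + m) = p + m • d := by
  induction m with
  | zero => simpa using hp
  | succ m ih =>
    rw [← add_assoc, t_succ (by omega), ih fun j hj => hd j (by omega), hd m (by omega),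
      succ_nsmul, add_assoc]

theorem t_left_of_corner {n j : ℕ} (h : t (4 * n ^ 2 + 1) = (-(n : ℤ), (n : ℤ)))
    (hj : j ≤ 2 * n) : t (4 * n ^ 2 + 1 + j) = (-(n : ℤ), (n : ℤ) - j) := by
  rw [t_add_of_step_eq (d := (0, -1)) (by omega) h fun i hi => ?_]
  · simp [sub_eq_add_neg]
  · simpa using step_of_left (a := -(n : ℤ)) (b := n + -i) (by omega) (by omega)

theorem t_corner (n : ℕ) : t (4 * n ^ 2 + 1) = (-(n : ℤ), (n : ℤ)) := by
  induction n with
  | zero => simp [t]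
  | succ n ih =>
    have hleft := t_left_of_corner ih le_rfl
    have hbottom := t_add_of_step_eq (m := 2 * n + 1) (d := (1, 0)) (by omega) hleft fun i hi => by
      simpa using step_of_bottom (a := -(n : ℤ) + i) (b := n - 2 * n) (by omega) (by omega)
    have hright := t_add_of_step_eq (m := 2 * n + 1) (d := (0, 1)) (by omega) hbottom
      fun i hi => by
        simpa using step_of_right (a := -(n : ℤ) + (2 * n + 1)) (b := n - 2 * n + i)
          (by omega) (by omega)
    have htop := t_add_of_step_eq (m := 2 * n + 2) (d := (-1, 0)) (by omega) hright
      fun i hi => by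
        simpa using step_of_top (a := -(n : ℤ) + (2 * n + 1) + -i) (b := n - 2 * n + (2 * n + 1))
          (by omega) (by omega)
    convert htop using 1
    · congr 1
      ring
    · ext <;> simp <;> ring

theorem t_left {n j : ℕ} (hj : j ≤ 2 * n) :
    t (4 * n ^ 2 + 1 + j) = (-(n : ℤ), (n : ℤ) - j) :=
  t_left_of_corner (t_corner n) hj

end Spiral

open Spiral in
/-- If `t k = (x, y) ∈ D3` (so `x < 0`), then `k + 8x + 3 ≥ 1` and the point one step to
the right of `t k` has index `k + 8x + 3` in the spiral enumeration. -/
theorem spiral_right_index_D3 (k : ℕ) (hk : 1 ≤ k) (x y : ℤ)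
    (h : t k = (x, y)) (hm : (x, y) ∈ D3) :
    1 ≤ (k : ℤ) + 8 * x + 3 ∧ t ((k : ℤ) + 8 * x + 3).toNat = (x + 1, y) := by
  obtain ⟨-, h₁, h₂⟩ : x < 0 ∧ x < y ∧ y < -x := hm
  have hindex := index_t hk
  rw [h, index_of_left h₁ h₂.le] at hindex
  obtain ⟨n, hn⟩ := Int.eq_ofNat_of_zero_le (show 0 ≤ -x - 1 by omega)
  obtain ⟨j, hj⟩ := Int.eq_ofNat_of_zero_le (show 0 ≤ n - y by omega)
  obtain rfl : x = -n - 1 := by omega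
  obtain rfl : y = n - j := by omega
  have htarget : (k : ℤ) + 8 * (-n - 1) + 3 = (4 * n ^ 2 + 1 + j : ℕ) := by
    push_cast
    linear_combination -hindex
  rw [htarget, Int.toNat_natCast, t_left (by omega)]
  refine ⟨by omega, by simp⟩
end

section
/- Let G be a group with finite semigroup generating set S, let L ⊆ List Σ be a language over a finite alphabet Σ, and let ψ : L → G be a bijection. Suppose that for each s ∈ S there is a function f_s : List Σ → List Σ mapping L into L such that ψ(f_s(w)) = ψ(w)·s for all w ∈ L and such that the graph language {w ⊗ f_s(w) : w ∈ List Σ}, viewed as a language over the alphabet Option Σ × Option Σ, is regular (i.e., f_s is an automatic function). Then ψ is quasigeodesic. -/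
/-- The convolution of two strings: the `k`-th entry is the pair of the `k`-th entries of
`x` and `z`, with `none` used as padding past the end of the shorter string. -/
def conv {α β : Type} (x : List α) (z : List β) : List (Option α × Option β) :=
  List.ofFn fun i : Fin (max x.length z.length) => (x[i.1]?, z[i.1]?)

/-- The word metric with respect to a semigroup generating set `S`:
the least length of a word over `S` whose product is `g`. -/
noncomputable def dS {G : Type*} [Group G] (S : Set G) (g : G) : ℕ :=
  sInf {n | ∃ l : List G, (∀ x ∈ l, x ∈ S) ∧ l.prod = g ∧ l.length = n}

/-- A bijection `ψ : L ≃ G` is quasigeodesic (w.r.t. the semigroup generating set `S`) if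
for some constant `C > 0` the normal form of every `g ∈ G` has length at most
`C * (dS S g + 1)`. -/
def Quasigeodesic {G : Type*} [Group G] {α : Type*} (S : Set G) (L : Set (List α))
    (ψ : L ≃ G) : Prop :=
  ∃ C : ℕ, 0 < C ∧ ∀ g : G, (ψ.symm g : List α).length ≤ C * (dS S g + 1)

theorem map_fst_conv {α β : Type} (x : List α) (z : List β) :
    (conv x z).map Prod.fst = x.map some ++ List.replicate (z.length - x.length) none := by
  apply List.ext_getElem
  · simp [conv]
    omega
  · intro i h₁ h₂
    rcases lt_or_ge i x.length with hi | hi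
    · simp [conv, hi]
    · simp [conv, hi]

theorem filterMap_fst_conv {α β : Type} (x : List α) (z : List β) :
    (conv x z).filterMap Prod.fst = x := by
  have h : (conv x z).filterMap Prod.fst = ((conv x z).map Prod.fst).filterMap id := by
    simp [List.filterMap_map]
  rw [h, map_fst_conv]
  simp [List.filterMap_map]

theorem fst_eq_none_of_mem_drop_conv {α β : Type} {x : List α} {z : List β}
    {p : Option α × Option β} (hp : p ∈ (conv x z).drop x.length) : p.1 = none := by
  have h : p.1 ∈ ((conv x z).drop x.length).map Prod.fst := List.mem_map_of_mem hp
  rw [List.map_drop, map_fst_conv] at h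
  simp at h
  exact h.2

/-- An automatic function increases lengths by at most a constant. -/
theorem exists_length_le_of_isRegular_graph {α β : Type} {f : List α → List β}
    (hf : Language.IsRegular
      {w : List (Option α × Option β) | ∃ x : List α, w = conv x (f x)}) :
    ∃ K : ℕ, ∀ x, (f x).length ≤ x.length + K := by
  obtain ⟨σ, _, M, hM⟩ := hf
  refine ⟨Fintype.card σ, fun x => ?_⟩
  by_contra! hlt
  have hacc (w) : w ∈ M.accepts ↔ ∃ y, w = conv y (f y) := by rw [hM]; rfl
  have hx := (hacc _).2 ⟨x, rfl⟩
  have hlen : Fintype.card σ ≤ ((conv x (f x)).drop x.length).length := by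
    simp [conv]
    omega
  obtain ⟨q, a, b, c, habc, -, hb, ha, -, hc⟩ := M.evalFrom_split
    (s := M.eval ((conv x (f x)).take x.length)) hlen rfl
  have hsplit : conv x (f x) = (conv x (f x)).take x.length ++ (a ++ b ++ c) := by
    rw [← habc, List.take_append_drop]
  have hnone : ∀ p ∈ a ++ b ++ c, p.1 = none := fun p hp =>
    fst_eq_none_of_mem_drop_conv (habc ▸ hp)
  have hfm {l : List (Option α × Option β)} (hl : ∀ p ∈ l, p.1 = none) :
      l.filterMap Prod.fst = [] := List.filterMap_eq_nil_iff.2 hl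
  have hshort : (conv x (f x)).take x.length ++ (a ++ c) ∈ M.accepts := by
    rw [DFA.mem_accepts] at hx ⊢
    have e : M.eval ((conv x (f x)).take x.length ++ (a ++ c)) = M.eval (conv x (f x)) := by
      conv_rhs => rw [← List.take_append_drop x.length (conv x (f x))]
      simp only [DFA.eval, DFA.evalFrom_of_append] at ha hc ⊢
      rw [ha, hc]
    rwa [e]
  obtain ⟨y, hy⟩ := (hacc _).1 hshort
  have hyx : y = x := by
    have hfx := congrArg (List.filterMap Prod.fst) hsplit
    have hfy := congrArg (List.filterMap Prod.fst) hy
    rw [filterMap_fst_conv, List.filterMap_append, hfm hnone] at hfx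
    rw [filterMap_fst_conv, List.filterMap_append,
      hfm (l := a ++ c) fun p hp => hnone p (by simp at hp ⊢; tauto)] at hfy
    exact hfy.symm.trans hfx.symm
  rw [hyx] at hy
  have hlen_b := List.length_pos_of_ne_nil hb
  have hlen_eq := congrArg List.length (hy.trans hsplit)
  simp only [List.length_append] at hlen_eq
  omega

/-- If a bijective representation `ψ : L ≃ G` admits, for each generator `s ∈ S`, an
automatic function `f_s` computing right multiplication by `s` on normal forms
(the graph language of `f_s` is regular), then `ψ` is quasigeodesic. -/
theorem quasigeodesic_of_automatic {G : Type} [Group G] {α : Type} [Fintype α]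
    (S : Finset G)
    (hgen : ∀ g : G, ∃ l : List G, (∀ x ∈ l, x ∈ S) ∧ l.prod = g)
    (L : Set (List α)) (ψ : L ≃ G)
    (h : ∀ s ∈ S, ∃ (f : List α → List α) (hL : ∀ w ∈ L, f w ∈ L),
      (∀ w : L, ψ ⟨f w.1, hL w.1 w.2⟩ = ψ w * s) ∧
      Language.IsRegular
        {w : List (Option α × Option α) | ∃ x : List α, w = conv x (f x)}) :
    Quasigeodesic (↑S) L ψ := by
  have hstep : ∀ s : S, ∃ K : ℕ, ∀ g : G,
      (ψ.symm (g * s) : List α).length ≤ (ψ.symm g : List α).length + K := by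
    rintro ⟨s, hs⟩
    obtain ⟨f, hL, hmul, hreg⟩ := h s hs
    obtain ⟨K, hK⟩ := exists_length_le_of_isRegular_graph hreg
    refine ⟨K, fun g => ?_⟩
    have hg := hmul (ψ.symm g)
    rw [Equiv.apply_symm_apply] at hg
    rw [← hg, Equiv.symm_apply_apply]
    exact hK _
  choose K hK using hstep
  have hword (l : List G) (hl : ∀ x ∈ l, x ∈ S) :
      (ψ.symm l.prod : List α).length ≤
        (ψ.symm 1 : List α).length + (∑ s, K s) * l.length := by
    induction l using List.reverseRecOn with
    | nil => simp
    | append_singleton l s ih =>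
      have hs : s ∈ S := hl s (by simp)
      have hle : K ⟨s, hs⟩ ≤ ∑ s, K s :=
        Finset.single_le_sum (fun _ _ => Nat.zero_le _) (Finset.mem_univ _)
      have hmul : (ψ.symm (l.prod * s) : List α).length ≤
          (ψ.symm l.prod : List α).length + K ⟨s, hs⟩ := hK ⟨s, hs⟩ l.prod
      have hl' := ih fun x hx => hl x (by simp [hx])
      simp only [List.prod_append, List.prod_singleton, List.length_append,
        List.length_singleton, mul_add, mul_one]
      omega
  refine ⟨(ψ.symm 1 : List α).length + (∑ s, K s) + 1, by omega, fun g => ?_⟩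
  obtain ⟨l₀, hl₀, hprod₀⟩ := hgen g
  obtain ⟨l, hl, hprod, hlen⟩ := Nat.sInf_mem
    (s := {n | ∃ l : List G, (∀ x ∈ l, x ∈ (S : Set G)) ∧ l.prod = g ∧ l.length = n})
    ⟨_, l₀, hl₀, hprod₀, rfl⟩
  have hbound := hword l hl
  rw [hprod, hlen] at hbound
  change _ ≤ _ + _ * dS (S : Set G) g at hbound
  calc _ ≤ _ := hbound
    _ ≤ (ψ.symm 1 : List α).length * (dS (S : Set G) g + 1)
        + (∑ s, K s) * (dS (S : Set G) g + 1) :=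
      Nat.add_le_add (Nat.le_mul_of_pos_right _ (Nat.succ_pos _))
        (Nat.mul_le_mul_left _ (Nat.le_succ _))
    _ ≤ _ := by rw [add_mul, add_mul]; omega
end
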